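/- Saturation for A-product states: let α : Matrix a a ℂ and β : Matrix (b × c) (b × c) ℂ be nonzero positive semidefinite matrices and let ρ = α ⊗ₖ β : Matrix (a × b × c) (a × b × c) ℂ (using the identification a × b × c = a × (b × c)). Then r(ρ_AB) · r(ρ_AC) = r(ρ_BC) if and only if r(α) = 1 and r(β) = r(β_B) · r(β_C), where β_B and β_C are the one-party reductions of β (e.g. β_B j l = ∑_{m : c} β (j,m) (l,m)). -/

import Mathlib

open Matrix
open scoped ComplexOrder

section
variable {a b c : Type*} [Fintype a] [Fintype b] [Fintype c]

/-- Partial trace over system `C` of a tripartite matrix. -/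
noncomputable def traceOutC (ρ : Matrix (a × b × c) (a × b × c) ℂ) :
    Matrix (a × b) (a × b) ℂ :=
  Matrix.of fun p q => ∑ m : c, ρ (p.1, p.2, m) (q.1, q.2, m)

/-- Partial trace over system `B` of a tripartite matrix. -/
noncomputable def traceOutB (ρ : Matrix (a × b × c) (a × b × c) ℂ) :
    Matrix (a × c) (a × c) ℂ :=
  Matrix.of fun p q => ∑ j : b, ρ (p.1, j, p.2) (q.1, j, q.2)

/-- Partial trace over system `A` of a tripartite matrix. -/
noncomputable def traceOutA (ρ : Matrix (a × b × c) (a × b × c) ℂ) :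
    Matrix (b × c) (b × c) ℂ :=
  Matrix.of fun p q => ∑ i : a, ρ (i, p.1, p.2) (i, q.1, q.2)

/-- Reduction onto system `A` of a tripartite matrix. -/
noncomputable def redA (ρ : Matrix (a × b × c) (a × b × c) ℂ) : Matrix a a ℂ :=
  Matrix.of fun i k => ∑ j : b, ∑ m : c, ρ (i, j, m) (k, j, m)

/-- Reduction onto system `B` of a tripartite matrix. -/
noncomputable def redB (ρ : Matrix (a × b × c) (a × b × c) ℂ) : Matrix b b ℂ :=
  Matrix.of fun j l => ∑ i : a, ∑ m : c, ρ (i, j, m) (i, l, m)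

/-- Reduction onto system `C` of a tripartite matrix. -/
noncomputable def redC (ρ : Matrix (a × b × c) (a × b × c) ℂ) : Matrix c c ℂ :=
  Matrix.of fun m m' => ∑ i : a, ∑ j : b, ρ (i, j, m) (i, j, m')

open scoped Kronecker

theorem aux_diag {n : Type*} [Fintype n] [DecidableEq n] (M : Matrix n n ℂ) :
    ∃ (V U : Matrix n n ℂ) (w : n → ℂ), IsUnit V.det ∧ IsUnit U.det ∧
      V * M * U = diagonal w ∧ ∀ i, w i * w i = w i := by
  obtain ⟨V, U, e, hV, hU, h⟩ := Matrix.exists_rank_normal_form M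
  refine ⟨V, U, fun i => Sum.elim (fun _ => 1) (fun _ => 0) (e i),
    (isUnit_iff_isUnit_det _).1 hV, (isUnit_iff_isUnit_det _).1 hU, ?_, ?_⟩
  · rw [h, ← diagonal_one, ← diagonal_zero, fromBlocks_diagonal, submatrix_diagonal_equiv]
    rfl
  · intro i
    rcases hx : e i with x | x <;> simp [hx]

theorem aux_rank_of_diag {n : Type*} [Fintype n] [DecidableEq n] {M V U : Matrix n n ℂ}
    {w : n → ℂ} (hV : IsUnit V.det) (hU : IsUnit U.det) (h : V * M * U = diagonal w) :
    M.rank = Nat.card {i // w i ≠ 0} := by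
  classical
  rw [Nat.card_eq_fintype_card, ← rank_diagonal, ← h, rank_mul_eq_left_of_isUnit_det U _ hU,
    rank_mul_eq_right_of_isUnit_det V _ hV]

theorem aux_rank_kronecker {m n : Type*} [Fintype m] [DecidableEq m] [Fintype n] [DecidableEq n]
    (A : Matrix m m ℂ) (B : Matrix n n ℂ) : (A ⊗ₖ B).rank = A.rank * B.rank := by
  obtain ⟨V, U, w, hV, hU, h, -⟩ := aux_diag A
  obtain ⟨V', U', w', hV', hU', h', -⟩ := aux_diag B
  have key : (V ⊗ₖ V') * (A ⊗ₖ B) * (U ⊗ₖ U') = diagonal fun p => w p.1 * w' p.2 := by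
    rw [← mul_kronecker_mul, ← mul_kronecker_mul, h, h', diagonal_kronecker_diagonal]
  have d1 : IsUnit (V ⊗ₖ V').det := by
    rw [det_kronecker]; exact (hV.pow _).mul (hV'.pow _)
  have d2 : IsUnit (U ⊗ₖ U').det := by
    rw [det_kronecker]; exact (hU.pow _).mul (hU'.pow _)
  rw [aux_rank_of_diag d1 d2 key, aux_rank_of_diag hV hU h, aux_rank_of_diag hV' hU' h',
    ← Nat.card_prod]
  refine Nat.card_congr ⟨fun x => (⟨x.1.1, left_ne_zero_of_mul x.2⟩,
    ⟨x.1.2, right_ne_zero_of_mul x.2⟩), fun y => ⟨(y.1.1, y.2.1), mul_ne_zero y.1.2 y.2.2⟩,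
    fun _ => rfl, fun _ => rfl⟩

theorem aux_proj {n : Type*} [Fintype n] [DecidableEq n] (M : Matrix n n ℂ) :
    ∃ P : Matrix n n ℂ, P * M = M ∧ P.rank ≤ M.rank := by
  obtain ⟨V, U, w, hV, hU, h, hw⟩ := aux_diag M
  refine ⟨M * (U * V), ?_, rank_mul_le_left _ _⟩
  have e : V * (M * (U * V) * M) * U = V * M * U := by
    have : V * (M * (U * V) * M) * U = (V * M * U) * (V * M * U) := by
      simp only [Matrix.mul_assoc]
    rw [this, h, diagonal_mul_diagonal]
    congr 1
    funext i
    exact hw i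
  have e2 := ((isUnit_iff_isUnit_det _).2 hU).mul_right_cancel e
  exact ((isUnit_iff_isUnit_det _).2 hV).mul_left_cancel e2

open scoped MatrixOrder in
theorem aux_factor {n : Type*} [Fintype n] [DecidableEq n] {M : Matrix n n ℂ}
    (hM : M.PosSemidef) : ∃ G : Matrix n n ℂ, M = G * Gᴴ := by
  obtain ⟨B, hB⟩ := CStarAlgebra.nonneg_iff_eq_star_mul_self.mp hM.nonneg
  exact ⟨Bᴴ, by rw [conjTranspose_conjTranspose]; exact hB⟩

theorem aux_fix {m n : Type*} [Fintype m] [DecidableEq m] [Fintype n] {P A : Matrix m m ℂ}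
    (M : Matrix m n ℂ) (hA : A = M * Mᴴ) (h : P * A = A) : P * M = M := by
  have : (P - 1) * (M * Mᴴ) = 0 := by rw [← hA, Matrix.sub_mul, h, Matrix.one_mul, sub_self]
  rw [mul_self_mul_conjTranspose_eq_zero, Matrix.sub_mul, Matrix.one_mul, sub_eq_zero] at this
  exact this

theorem aux_rank_le {b c : Type*} [Fintype b] [Fintype c] [DecidableEq b] [DecidableEq c]
    (β : Matrix (b × c) (b × c) ℂ) (hβ : β.PosSemidef) :
    β.rank ≤ (Matrix.of fun j l : b => ∑ m : c, β (j, m) (l, m)).rank *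
            (Matrix.of fun m m' : c => ∑ j : b, β (j, m) (j, m')).rank := by
  obtain ⟨G, hG⟩ := aux_factor hβ
  obtain ⟨P, hP, hPr⟩ := aux_proj (Matrix.of fun j l : b => ∑ m : c, β (j, m) (l, m))
  obtain ⟨Q, hQ, hQr⟩ := aux_proj (Matrix.of fun m m' : c => ∑ j : b, β (j, m) (j, m'))
  have hPM := aux_fix (Matrix.of fun (j : b) (x : c × (b × c)) => G (j, x.1) x.2)
    (by ext j l; simp [hG, Matrix.mul_apply, Fintype.sum_prod_type]) hP
  have hQM := aux_fix (Matrix.of fun (m : c) (x : b × (b × c)) => G (x.1, m) x.2)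
    (by ext j l; simp [hG, Matrix.mul_apply, Fintype.sum_prod_type]) hQ
  have h1 : (P ⊗ₖ (1 : Matrix c c ℂ)) * G = G := by
    ext ⟨j, m⟩ k
    have := congrFun (congrFun hPM j) (m, k)
    simp only [Matrix.mul_apply, Matrix.of_apply] at this
    rw [← this, Matrix.mul_apply, Fintype.sum_prod_type]
    simp [Matrix.one_apply]
  have h2 : ((1 : Matrix b b ℂ) ⊗ₖ Q) * G = G := by
    ext ⟨j, m⟩ k
    have := congrFun (congrFun hQM m) (j, k)
    simp only [Matrix.mul_apply, Matrix.of_apply] at this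
    rw [← this, Matrix.mul_apply, Fintype.sum_prod_type_right]
    simp [Matrix.one_apply]
  have h3 : (P ⊗ₖ Q) * β = β := by
    have : P ⊗ₖ Q = (P ⊗ₖ (1 : Matrix c c ℂ)) * ((1 : Matrix b b ℂ) ⊗ₖ Q) := by
      rw [← mul_kronecker_mul, Matrix.mul_one, Matrix.one_mul]
    rw [this, hG, ← Matrix.mul_assoc, Matrix.mul_assoc (P ⊗ₖ 1), h2, h1]
  calc β.rank = ((P ⊗ₖ Q) * β).rank := by rw [h3]
    _ ≤ (P ⊗ₖ Q).rank := rank_mul_le_left _ _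
    _ = P.rank * Q.rank := aux_rank_kronecker _ _
    _ ≤ _ := Nat.mul_le_mul hPr hQr

theorem aux_rank_pos {n : Type*} [Fintype n] [DecidableEq n] {M : Matrix n n ℂ} (h : M ≠ 0) :
    0 < M.rank := by
  rw [Nat.pos_iff_ne_zero]
  intro h0
  obtain ⟨P, hP, hPr⟩ := aux_proj M
  apply h
  rw [Matrix.rank, Submodule.finrank_eq_zero, LinearMap.range_eq_bot] at h0
  ext i j
  have := congrFun (LinearMap.congr_fun h0 (Pi.single j 1)) i
  simpa using this

/-- Saturation for `A`-product states: for `ρ = α ⊗ₖ β` with `α`, `β` nonzero positive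
semidefinite, `r(ρ_AB) · r(ρ_AC) = r(ρ_BC)` if and only if `r(α) = 1` and
`r(β) = r(β_B) · r(β_C)`. -/
theorem saturation_iff_of_A_product
    [DecidableEq a] [DecidableEq b] [DecidableEq c]
    (α : Matrix a a ℂ) (β : Matrix (b × c) (b × c) ℂ)
    (hα : α.PosSemidef) (hβ : β.PosSemidef) (hα0 : α ≠ 0) (hβ0 : β ≠ 0) :
    (traceOutC (α ⊗ₖ β)).rank * (traceOutB (α ⊗ₖ β)).rank =
        (traceOutA (α ⊗ₖ β)).rank ↔
      α.rank = 1 ∧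
        β.rank =
          (Matrix.of fun j l : b => ∑ m : c, β (j, m) (l, m)).rank *
            (Matrix.of fun m m' : c => ∑ j : b, β (j, m) (j, m')).rank := by
  have hC : traceOutC (α ⊗ₖ β) =
      α ⊗ₖ (Matrix.of fun j l : b => ∑ m : c, β (j, m) (l, m)) := by
    ext ⟨i, j⟩ ⟨k, l⟩
    simp [traceOutC, Finset.mul_sum]
  have hB : traceOutB (α ⊗ₖ β) =
      α ⊗ₖ (Matrix.of fun m m' : c => ∑ j : b, β (j, m) (j, m')) := by
    ext ⟨i, j⟩ ⟨k, l⟩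
    simp [traceOutB, Finset.mul_sum]
  have hA : traceOutA (α ⊗ₖ β) = α.trace • β := by
    ext ⟨i, j⟩ ⟨k, l⟩
    simp [traceOutA, Finset.sum_mul, Matrix.trace]
  have ht : α.trace ≠ 0 := fun h => hα0 (hα.trace_eq_zero_iff.1 h)
  rw [hC, hB, hA, rank_smul_of_mem_nonZeroDivisors β (mem_nonZeroDivisors_of_ne_zero ht),
    aux_rank_kronecker, aux_rank_kronecker]
  have hle := aux_rank_le β hβ
  have hα1 := aux_rank_pos hα0
  have hβ1 := aux_rank_pos hβ0
  generalize (Matrix.of fun j l : b => ∑ m : c, β (j, m) (l, m)).rank = x at *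
  generalize (Matrix.of fun m m' : c => ∑ j : b, β (j, m) (j, m')).rank = y at *
  generalize α.rank = r at *
  generalize β.rank = s at *
  constructor
  · intro h
    have hr : r = 1 := by
      by_contra hne
      have h2 : 2 ≤ r := by omega
      have h3 : r * x * (r * y) = (r * r) * (x * y) := by ring
      have h4 : 2 * 2 ≤ r * r := Nat.mul_le_mul h2 h2
      have h5 := Nat.mul_le_mul_right (x * y) h4
      omega
    subst hr
    exact ⟨rfl, by rw [← h]; ring⟩
  · rintro ⟨rfl, rfl⟩
    ring

end
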